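/- (Proposition 1) A Nash equilibrium of the local public goods game always exists: there exists a profile s* = (x*, y*, g*) such that no player can strictly increase her utility by simultaneously changing her own contributions and links. -/

import Mathlib

open Filter

noncomputable section

/-- `(x, y)` is an isolation demand for taste `t`: a maximizer of
`t·f(x) + (1−t)·f(y) − c·(x+y)` over nonnegative contributions. -/
def IsIsolationDemand (f : ℝ → ℝ) (c t x y : ℝ) : Prop :=
  0 ≤ x ∧ 0 ≤ y ∧
  ∀ x' y' : ℝ, 0 ≤ x' → 0 ≤ y' →
    t * f x' + (1 - t) * f y' - c * (x' + y') ≤ t * f x + (1 - t) * f y - c * (x + y)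

/-- Maintained assumptions on the benefit function `f`: twice continuously
differentiable, strictly increasing, strictly concave on `[0,∞)`, with
`lim_{z→0⁺} f′(z) > c` (possibly `+∞`, hence an `EReal` limit) and
`lim_{z→∞} f′(z) = m < c`. -/
def BenefitAssumptions (f : ℝ → ℝ) (c : ℝ) : Prop :=
  ContDiffOn ℝ 2 f (Set.Ici 0) ∧ StrictMonoOn f (Set.Ici 0) ∧
  StrictConcaveOn ℝ (Set.Ici 0) f ∧
  (∃ L : EReal, Tendsto (fun z => Real.toEReal (deriv f z)) (nhdsWithin 0 (Set.Ioi 0)) (nhds L) ∧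
    (c : EReal) < L) ∧
  (∃ m : ℝ, Tendsto (deriv f) atTop (nhds m) ∧ m < c)

/-- Spillovers of a good with contribution profile `x` received by `i`
through the links she sponsors in `g`. -/
def spill {n : ℕ} (x : Fin n → ℝ) (g : Fin n → Fin n → Bool) (i : Fin n) : ℝ :=
  ∑ j, if g i j then x j else 0

/-- Number of links sponsored by `i` (as a real number). -/
def nlinks {n : ℕ} (g : Fin n → Fin n → Bool) (i : Fin n) : ℝ :=
  ∑ j, if g i j then (1 : ℝ) else 0

/-- Utility of player `i` under the strategy profile `(x, y, g)`. -/
def payoff {n : ℕ} (t : Fin n → ℝ) (f : ℝ → ℝ) (c k : ℝ)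
    (x y : Fin n → ℝ) (g : Fin n → Fin n → Bool) (i : Fin n) : ℝ :=
  t i * f (x i + spill x g i) + (1 - t i) * f (y i + spill y g i)
    - c * (x i + y i) - nlinks g i * k

/-- Replace player `i`'s row of links by `gi`. -/
def updLinks {n : ℕ} (g : Fin n → Fin n → Bool) (i : Fin n) (gi : Fin n → Bool) :
    Fin n → Fin n → Bool :=
  fun a b => if a = i then gi b else g a b

/-- Nash equilibrium: contributions are nonnegative, nobody links to herself,
and no player can strictly gain by simultaneously changing her own
contributions and links. -/
def NashEq {n : ℕ} (t : Fin n → ℝ) (f : ℝ → ℝ) (c k : ℝ)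
    (x y : Fin n → ℝ) (g : Fin n → Fin n → Bool) : Prop :=
  (∀ i, 0 ≤ x i) ∧ (∀ i, 0 ≤ y i) ∧ (∀ i, g i i = false) ∧
  ∀ (i : Fin n) (xi yi : ℝ) (gi : Fin n → Bool), 0 ≤ xi → 0 ≤ yi → gi i = false →
    payoff t f c k (Function.update x i xi) (Function.update y i yi) (updLinks g i gi) i
      ≤ payoff t f c k x y g i

/-- Assumptions on taste parameters: pairwise distinct, in `[0,1]`, and the
extreme types `0` and `1` are realized. -/
def TypeAssumptions {n : ℕ} (t : Fin n → ℝ) : Prop :=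
  Function.Injective t ∧ (∀ i, t i ∈ Set.Icc (0:ℝ) 1) ∧ (∃ i, t i = 0) ∧ (∃ i, t i = 1)

/-- `i` is a large contributor in `g`: she receives at least one link. -/
def isContributor {n : ℕ} (g : Fin n → Fin n → Bool) (i : Fin n) : Prop :=
  ∃ j, g j i = true

/-- `i` is isolated in `g`: she neither sponsors nor receives links. -/
def isIsolated {n : ℕ} (g : Fin n → Fin n → Bool) (i : Fin n) : Prop :=
  (∀ j, g i j = false) ∧ (∀ j, g j i = false)

/-- `Z` maximizes `w·f(z) − c·z` over `z ≥ 0`. -/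
def IsMaxZ (f : ℝ → ℝ) (c w Z : ℝ) : Prop :=
  0 ≤ Z ∧ ∀ z, 0 ≤ z → w * f z - c * z ≤ w * f Z - c * Z

/-- Indirect value of one good given spillover `a`. -/
def val (f : ℝ → ℝ) (c w Z a : ℝ) : ℝ := w * f (max Z a) - c * (max Z a - a)

lemma exists_isMaxZ {f : ℝ → ℝ} {c : ℝ} (hB : BenefitAssumptions f c) {w : ℝ}
    (hw0 : 0 ≤ w) (hw1 : w ≤ 1) : ∃ Z, IsMaxZ f c w Z := by
  obtain ⟨hD, hM, hC, -, m, hm, hmc⟩ := hB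
  obtain ⟨A, hA1, hA2⟩ : ∃ A : ℝ, deriv f A < c ∧ 0 < A :=
    ((hm.eventually (gt_mem_nhds hmc)).and (eventually_gt_atTop 0)).exists
  have hdiff : DifferentiableAt ℝ f A :=
    ((hD.differentiableOn (by norm_num)) A hA2.le).differentiableAt (Ici_mem_nhds hA2)
  have htan : ∀ z, A ≤ z → f z - f A ≤ c * (z - A) := by
    intro z hz
    rcases hz.eq_or_lt with rfl | hz
    · simp
    have h1 : slope f A z ≤ deriv f A :=
      hC.concaveOn.slope_le_deriv (show A ∈ Set.Ici (0:ℝ) from hA2.le)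
        (show z ∈ Set.Ici (0:ℝ) from (hA2.trans hz).le) hz hdiff
    rw [slope_def_field, div_le_iff₀ (by linarith)] at h1
    nlinarith
  have hcont : ContinuousOn (fun z => w * f z - c * z) (Set.Icc 0 A) := by
    have : ContinuousOn f (Set.Icc 0 A) := hD.continuousOn.mono Set.Icc_subset_Ici_self
    fun_prop
  obtain ⟨Z, hZ, hmax⟩ := isCompact_Icc.exists_isMaxOn ⟨0, Set.left_mem_Icc.2 hA2.le⟩ hcont
  refine ⟨Z, hZ.1, fun z hz => ?_⟩
  by_cases hzA : z ≤ A
  · exact hmax ⟨hz, hzA⟩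
  · push Not at hzA
    have h1 := hmax (Set.right_mem_Icc.2 hA2.le)
    simp only [Set.mem_setOf_eq] at h1
    have h2 := htan z hzA.le
    have h3 : f A ≤ f z := hM.monotoneOn hA2.le hz hzA.le
    nlinarith

section one
variable {f : ℝ → ℝ} {c w Z : ℝ}

/-- `w f − c z` is antitone beyond the maximizer. -/
lemma anti_of_max (hC : ConcaveOn ℝ (Set.Ici 0) f) (hw : 0 ≤ w) (hZ : IsMaxZ f c w Z)
    {p q : ℝ} (hp : Z ≤ p) (hq : p ≤ q) : w * f q - c * q ≤ w * f p - c * p := by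
  have hu : ConcaveOn ℝ (Set.Ici 0) (fun z => w * f z - c * z) := by
    have h1 : ConcaveOn ℝ (Set.Ici 0) (fun z => w * f z) := hC.smul hw
    refine ⟨convex_Ici 0, ?_⟩
    intro a ha b hb s r hs hr hsr
    have := h1.2 ha hb hs hr hsr
    simp only [smul_eq_mul] at this ⊢
    linarith
  rcases hp.eq_or_lt with rfl | hp
  · exact hZ.2 q (hZ.1.trans hq)
  have h0 := hZ.1
  have hmem : p ∈ segment ℝ Z q := by
    rw [segment_eq_Icc (hp.le.trans hq)]; exact ⟨hp.le, hq⟩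
  have := hu.min_le_of_mem_segment (show Z ∈ Set.Ici (0:ℝ) from h0)
    (show q ∈ Set.Ici (0:ℝ) from h0.trans (hp.le.trans hq)) hmem
  have h2 := hZ.2 q (h0.trans (hp.le.trans hq))
  rw [min_eq_right h2] at this
  exact this

lemma val_ge (hC : ConcaveOn ℝ (Set.Ici 0) f) (hw : 0 ≤ w) (hZ : IsMaxZ f c w Z)
    {a z : ℝ} (ha : 0 ≤ a) (hz : a ≤ z) : w * f z - c * (z - a) ≤ val f c w Z a := by
  unfold val
  rcases le_total Z a with h | h
  · rw [max_eq_right h]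
    have := anti_of_max hC hw hZ h hz
    linarith
  · rw [max_eq_left h]
    have := hZ.2 z (ha.trans hz)
    linarith

lemma val_add_le (hC : ConcaveOn ℝ (Set.Ici 0) f) (hw : 0 ≤ w) (hZ : IsMaxZ f c w Z)
    {a b : ℝ} (ha : 0 ≤ a) (hb : 0 ≤ b) : val f c w Z (a + b) ≤ val f c w Z a + c * b := by
  have := val_ge hC hw hZ ha (z := max Z (a + b)) (le_max_of_le_right (by linarith))
  unfold val at this ⊢
  linarith

lemma val_subadd (hC : ConcaveOn ℝ (Set.Ici 0) f) (hw : 0 ≤ w) (hZ : IsMaxZ f c w Z)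
    {a b : ℝ} (ha : 0 ≤ a) (hb : 0 ≤ b) :
    val f c w Z (a + b) + val f c w Z 0 ≤ val f c w Z a + val f c w Z b := by
  have h0 := hZ.1
  unfold val
  rw [max_eq_left h0]
  rcases le_total a Z with h | h
  · rw [max_eq_left h]
    have := anti_of_max hC hw hZ (le_max_left Z b) (max_le_max_left Z (by linarith : b ≤ a + b))
    linarith
  rcases le_total b Z with h' | h'
  · rw [max_eq_left h']
    have := anti_of_max hC hw hZ (le_max_left Z a) (max_le_max_left Z (by linarith : a ≤ a + b))
    linarith
  rw [max_eq_right h, max_eq_right h', max_eq_right (by linarith)]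
  have h1 := anti_of_max hC hw hZ (p := a + b - Z) (q := a + b) (by linarith) (by linarith)
  -- concavity with the points Z ≤ a, b ≤ a + b - Z
  have h2 : f (a + b - Z) + f Z ≤ f a + f b := by
    rcases eq_or_lt_of_le (show Z ≤ a + b - Z by linarith) with h3 | h3
    · have : a = Z := by linarith
      have : b = Z := by linarith
      subst_vars
      simp
    · have hd : 0 < a + b - Z - Z := by linarith
      set s := (b - Z) / (a + b - Z - Z) with hs
      have hs0 : 0 ≤ s := div_nonneg (by linarith) hd.le
      have hs1 : s ≤ 1 := (div_le_one hd).2 (by linarith)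
      have hsd : s * (a + b - Z - Z) = b - Z := div_mul_cancel₀ _ hd.ne'
      have e1 := hC.2 (show Z ∈ Set.Ici (0:ℝ) from h0)
        (show a + b - Z ∈ Set.Ici (0:ℝ) from by simp only [Set.mem_Ici]; linarith)
        (sub_nonneg.2 hs1) hs0 (by ring)
      have e2 := hC.2 (show Z ∈ Set.Ici (0:ℝ) from h0)
        (show a + b - Z ∈ Set.Ici (0:ℝ) from by simp only [Set.mem_Ici]; linarith)
        hs0 (sub_nonneg.2 hs1) (by ring)
      simp only [smul_eq_mul] at e1 e2
      rw [show (1 - s) * Z + s * (a + b - Z) = b by linarith] at e1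
      rw [show s * Z + (1 - s) * (a + b - Z) = a by linarith] at e2
      linarith
  nlinarith

lemma val_small {a : ℝ} (h0 : 0 ≤ Z) (h : a ≤ Z) :
    val f c w Z a - val f c w Z 0 = c * a := by
  unfold val
  rw [max_eq_left h, max_eq_left h0]; ring

/-- Gains from a big contributor cover at least the own contribution. -/
lemma val_big (hM : MonotoneOn f (Set.Ici 0)) (hw : 0 ≤ w) (h0 : 0 ≤ Z)
    {a b : ℝ} (ha : 0 ≤ a) (hb : Z ≤ b) :
    val f c w Z a + c * (max Z a - a) ≤ val f c w Z (a + b) := by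
  unfold val
  rw [max_eq_right (by linarith : Z ≤ a + b)]
  have : f (max Z a) ≤ f (a + b) :=
    hM (show max Z a ∈ Set.Ici (0:ℝ) from h0.trans (le_max_left _ _))
      (show a + b ∈ Set.Ici (0:ℝ) from by simp only [Set.mem_Ici]; linarith)
      (max_le (by linarith) (by linarith))
  nlinarith

lemma val_mono_type (hM : MonotoneOn f (Set.Ici 0)) {w' Z' b : ℝ} (hww : w ≤ w')
    (hZ : IsMaxZ f c w Z) (h0' : 0 ≤ Z') (h1 : Z ≤ Z') (h2 : Z' ≤ b) :
    val f c w Z b - val f c w Z 0 ≤ val f c w' Z' b - val f c w' Z' 0 := by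
  unfold val
  rw [max_eq_right h2, max_eq_right (h1.trans h2), max_eq_left h0', max_eq_left hZ.1]
  have e1 := hZ.2 Z' h0'
  have e2 : f Z' ≤ f b := hM h0' (h0'.trans h2) h2
  nlinarith

lemma max_mono (hM : StrictMonoOn f (Set.Ici 0)) {w' Z' : ℝ} (hww : w < w')
    (hZ : IsMaxZ f c w Z) (hZ' : IsMaxZ f c w' Z') : Z ≤ Z' := by
  by_contra! h
  have e1 := hZ.2 Z' hZ'.1
  have e2 := hZ'.2 Z hZ.1
  have e3 := hM hZ'.1 hZ.1 h
  nlinarith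

end one

/-- Kernels exist for digraphs whose in-neighbourhoods are intervals. -/
lemma exists_kernel {ι : Type*} [DecidableEq ι] (A : ι → ι → Prop) (t : ι → ℝ)
    (ht : Function.Injective t)
    (h1 : ∀ i j l, t i < t j → t j < t l → A i l → A j l)
    (h2 : ∀ i j l, t i < t j → t j < t l → A l i → A j i) (S : Finset ι) :
    ∃ K ⊆ S, (∀ a ∈ K, ∀ b ∈ K, a ≠ b → ¬ A a b) ∧
      ∀ i ∈ S, i ∉ K → ∃ a ∈ K, A i a := by
  classical
  induction S using Finset.strongInduction with
  | H S ih =>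
  rcases S.eq_empty_or_nonempty with rfl | hne
  · exact ⟨∅, by simp⟩
  obtain ⟨m, hm, hmax⟩ := S.exists_max_image t hne
  have hlt : ∀ i ∈ S, i ≠ m → t i < t m := fun i hi hne =>
    lt_of_le_of_ne (hmax i hi) (fun h => hne (ht h))
  obtain ⟨K, hKS, hKi, hKa⟩ := ih (S.filter (fun i => i ≠ m ∧ ¬ A i m))
    (Finset.filter_ssubset.2 ⟨m, hm, by simp⟩)
  have hK : ∀ a ∈ K, a ∈ S ∧ a ≠ m ∧ ¬ A a m := fun a ha => by
    simpa using hKS ha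
  by_cases hma : ∃ a ∈ K, A m a
  · obtain ⟨a, ha, hA⟩ := hma
    refine ⟨K, fun a ha => (hK a ha).1, hKi, fun i hi hiK => ?_⟩
    by_cases him : i = m
    · exact ⟨a, ha, him ▸ hA⟩
    by_cases hAi : A i m
    · obtain ⟨haS, ham, hAa⟩ := hK a ha
      refine ⟨a, ha, h2 a i m ?_ (hlt i hi him) hA⟩
      rcases lt_trichotomy (t a) (t i) with h | h | h
      · exact h
      · exact absurd (ht h ▸ ha) hiK
      · exact absurd (h1 i a m h (hlt a haS ham) hAi) hAa
    · exact hKa i (by simp [hi, him, hAi]) hiK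
  · push Not at hma
    refine ⟨insert m K, ?_, ?_, ?_⟩
    · intro a ha
      rcases Finset.mem_insert.1 ha with rfl | ha
      · exact hm
      · exact (hK a ha).1
    · intro a ha b hb hab
      rcases Finset.mem_insert.1 ha with ha1 | ha1
      · rcases Finset.mem_insert.1 hb with hb1 | hb1
        · exact absurd (ha1.trans hb1.symm) hab
        · rw [ha1]; exact hma b hb1
      · rcases Finset.mem_insert.1 hb with hb1 | hb1
        · rw [hb1]; exact (hK a ha1).2.2
        · exact hKi a ha1 b hb1 hab
    · intro i hi hiK
      simp only [Finset.mem_insert, not_or] at hiK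
      by_cases hAi : A i m
      · exact ⟨m, by simp, hAi⟩
      · obtain ⟨a, ha, hA⟩ := hKa i (by simp [hi, hiK.1, hAi]) hiK.2
        exact ⟨a, by simp [ha], hA⟩

/-- Proposition 1: a Nash equilibrium always exists. -/
theorem statement4 {n : ℕ} (hn : 3 ≤ n)
    (t : Fin n → ℝ) (hT : TypeAssumptions t)
    (f : ℝ → ℝ) (c k : ℝ) (hc : 0 < c) (hk : 0 < k)
    (hB : BenefitAssumptions f c) :
    ∃ (x y : Fin n → ℝ) (g : Fin n → Fin n → Bool), NashEq t f c k x y g := by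
  classical
  obtain ⟨hinj, ht01, ⟨p0, hp0⟩, ⟨p1, hp1⟩⟩ := hT
  have hSM := hB.2.1
  have hM : MonotoneOn f (Set.Ici 0) := hSM.monotoneOn
  have hC : ConcaveOn ℝ (Set.Ici 0) f := hB.2.2.1.concaveOn
  have hw : ∀ i, 0 ≤ t i := fun i => (ht01 i).1
  have hw' : ∀ i, 0 ≤ 1 - t i := fun i => by linarith [(ht01 i).2]
  choose X hX using fun i => exists_isMaxZ hB (hw i) (ht01 i).2
  choose Y hY using fun i => exists_isMaxZ hB (hw' i) (by linarith [hw i])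
  have hX0 : ∀ i, 0 ≤ X i := fun i => (hX i).1
  have hY0 : ∀ i, 0 ≤ Y i := fun i => (hY i).1
  have Xm : ∀ i j, t i < t j → X i ≤ X j := fun i j h => max_mono hSM h (hX i) (hX j)
  have Ym : ∀ i j, t i < t j → Y j ≤ Y i := fun i j h =>
    max_mono hSM (by linarith) (hY j) (hY i)
  have Xm' : ∀ i j, t i ≤ t j → X i ≤ X j := fun i j h => by
    rcases h.eq_or_lt with h | h
    · rw [hinj h]
    · exact Xm i j h
  have Ym' : ∀ i j, t i ≤ t j → Y j ≤ Y i := fun i j h => by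
    rcases h.eq_or_lt with h | h
    · rw [hinj h]
    · exact Ym i j h
  have Xp0 : X p0 = 0 := by
    have := (hX p0).2 0 le_rfl
    rw [hp0] at this
    nlinarith [hX0 p0]
  have Yp1 : Y p1 = 0 := by
    have := (hY p1).2 0 le_rfl
    rw [hp1] at this
    nlinarith [hY0 p1]
  have Xp1 : ∀ i, X i ≤ X p1 := fun i => Xm' i p1 (hp1 ▸ (ht01 i).2)
  have Yp0 : ∀ i, Y i ≤ Y p0 := fun i => Ym' p0 i (hp0 ▸ (ht01 i).1)
  -- indirect values
  obtain ⟨φ, hφ⟩ : ∃ φ : Fin n → ℝ → ℝ, φ = fun i a => val f c (t i) (X i) a := ⟨_, rfl⟩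
  obtain ⟨ψ, hψ⟩ : ∃ ψ : Fin n → ℝ → ℝ, ψ = fun i a => val f c (1 - t i) (Y i) a := ⟨_, rfl⟩
  have φadd : ∀ i a b, 0 ≤ a → 0 ≤ b → φ i (a + b) ≤ φ i a + c * b := fun i a b ha hb => by
    rw [hφ]; exact val_add_le hC (hw i) (hX i) ha hb
  have ψadd : ∀ i a b, 0 ≤ a → 0 ≤ b → ψ i (a + b) ≤ ψ i a + c * b := fun i a b ha hb => by
    rw [hψ]; exact val_add_le hC (hw' i) (hY i) ha hb
  have φsub : ∀ i a b, 0 ≤ a → 0 ≤ b → φ i (a + b) + φ i 0 ≤ φ i a + φ i b :=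
    fun i a b ha hb => by rw [hφ]; exact val_subadd hC (hw i) (hX i) ha hb
  have ψsub : ∀ i a b, 0 ≤ a → 0 ≤ b → ψ i (a + b) + ψ i 0 ≤ ψ i a + ψ i b :=
    fun i a b ha hb => by rw [hψ]; exact val_subadd hC (hw' i) (hY i) ha hb
  have φsmall : ∀ i a, a ≤ X i → φ i a - φ i 0 = c * a := fun i a h => by
    rw [hφ]; exact val_small (hX0 i) h
  have ψsmall : ∀ i a, a ≤ Y i → ψ i a - ψ i 0 = c * a := fun i a h => by
    rw [hψ]; exact val_small (hY0 i) h
  have φbig : ∀ i a, 0 ≤ a → φ i a + c * (max (X i) a - a) ≤ φ i (a + X p1) :=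
    fun i a ha => by rw [hφ]; exact val_big hM (hw i) (hX0 i) ha (Xp1 i)
  have ψbig : ∀ i a, 0 ≤ a → ψ i a + c * (max (Y i) a - a) ≤ ψ i (a + Y p0) :=
    fun i a ha => by rw [hψ]; exact val_big hM (hw' i) (hY0 i) ha (Yp0 i)
  -- arcs
  obtain ⟨A, hA⟩ : ∃ A : Fin n → Fin n → Prop, ∀ i j, A i j ↔
      k < φ i (X j) - φ i 0 + (ψ i (Y j) - ψ i 0) := ⟨_, fun i j => Iff.rfl⟩
  have hA1 : ∀ i j l, t i < t j → t j < t l → A i l → A j l := by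
    intro i j l hij hjl h
    rw [hA] at h ⊢
    have e1 := ψsmall i (Y l) (Ym _ _ (hij.trans hjl))
    have e2 := ψsmall j (Y l) (Ym _ _ hjl)
    have e3 : φ i (X l) - φ i 0 ≤ φ j (X l) - φ j 0 := by
      rw [hφ]
      exact val_mono_type hM hij.le (hX i) (hX0 j) (Xm _ _ hij) (Xm _ _ hjl)
    linarith
  have hA2 : ∀ i j l, t i < t j → t j < t l → A l i → A j i := by
    intro i j l hij hjl h
    rw [hA] at h ⊢
    have e1 := φsmall l (X i) (Xm _ _ (hij.trans hjl))
    have e2 := φsmall j (X i) (Xm _ _ hij)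
    have e3 : ψ l (Y i) - ψ l 0 ≤ ψ j (Y i) - ψ j 0 := by
      rw [hψ]
      exact val_mono_type hM (by linarith) (hY l) (hY0 j) (Ym _ _ hjl) (Ym _ _ hij)
    linarith
  obtain ⟨K, hKS, hKi, hKa⟩ := exists_kernel A t hinj hA1 hA2
    (Finset.univ.filter (fun i => ¬ A i p0 ∧ ¬ A i p1))
  have hK : ∀ a ∈ K, ¬ A a p0 ∧ ¬ A a p1 := fun a ha => by simpa using hKS ha
  have hp0A : ∀ j, A p0 j → A j p0 := by
    intro j h
    rw [hA] at h ⊢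
    have e1 := ψsmall p0 (Y j) (Yp0 j)
    have e2 : φ p0 (X j) - φ p0 0 = 0 := by
      rw [hφ]
      simp [val, hp0, Xp0, max_eq_right (hX0 j)]
    have e3 := ψbig j 0 le_rfl
    rw [max_eq_left (hY0 j), zero_add, sub_zero] at e3
    rw [Xp0]
    linarith
  have hp1A : ∀ j, A p1 j → A j p1 := by
    intro j h
    rw [hA] at h ⊢
    have e1 := φsmall p1 (X j) (Xp1 j)
    have e2 : ψ p1 (Y j) - ψ p1 0 = 0 := by
      rw [hψ]
      simp [val, hp1, Yp1, max_eq_right (hY0 j)]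
    have e3 := φbig j 0 le_rfl
    rw [max_eq_left (hX0 j), zero_add, sub_zero] at e3
    rw [Yp1]
    linarith
  have hp01 : ¬ A p0 p1 := by
    rw [hA]
    have e2 : φ p0 (X p1) - φ p0 0 = 0 := by
      rw [hφ]
      simp [val, hp0, Xp0, max_eq_right (hX0 p1)]
    rw [Yp1, e2]
    linarith
  have hp10 : ¬ A p1 p0 := fun h => hp01 (hp1A _ h)
  obtain ⟨M, hMdef⟩ : ∃ M, M = insert p0 (insert p1 K) := ⟨_, rfl⟩
  have hMi : ∀ a ∈ M, ∀ b ∈ M, a ≠ b → ¬ A a b := by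
    intro a ha b hb hab
    rw [hMdef] at ha hb
    simp only [Finset.mem_insert] at ha hb
    rcases ha with rfl | rfl | ha <;> rcases hb with rfl | rfl | hb
    · exact absurd rfl hab
    · exact hp01
    · exact fun h => (hK b hb).1 (hp0A b h)
    · exact hp10
    · exact absurd rfl hab
    · exact fun h => (hK b hb).2 (hp1A b h)
    · exact (hK a ha).1
    · exact (hK a ha).2
    · exact hKi a ha b hb hab
  have hMa : ∀ i, i ∉ M → ∃ a ∈ M, A i a := by
    intro i hi
    rw [hMdef] at hi ⊢
    simp only [Finset.mem_insert, not_or] at hi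
    by_cases h0 : A i p0
    · exact ⟨p0, by simp, h0⟩
    by_cases h1 : A i p1
    · exact ⟨p1, by simp, h1⟩
    obtain ⟨a, ha, h⟩ := hKa i (by simp [h0, h1]) hi.2.2
    exact ⟨a, by simp [ha], h⟩
  have hp0M : p0 ∈ M := by simp [hMdef]
  have hp1M : p1 ∈ M := by simp [hMdef]
  clear hMdef hKS hKi hKa hK
  -- values of link sets
  obtain ⟨B, hBd⟩ : ∃ B : Fin n → Finset (Fin n) → ℝ, ∀ i T, B i T =
      φ i (∑ j ∈ T, X j) + ψ i (∑ j ∈ T, Y j) - T.card * k := ⟨_, fun i T => rfl⟩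
  have sX0 : ∀ T : Finset (Fin n), 0 ≤ ∑ j ∈ T, X j := fun T =>
    Finset.sum_nonneg fun j _ => hX0 j
  have sY0 : ∀ T : Finset (Fin n), 0 ≤ ∑ j ∈ T, Y j := fun T =>
    Finset.sum_nonneg fun j _ => hY0 j
  have hBM : ∀ i ∈ M, ∀ T ⊆ M.erase i, B i T ≤ B i ∅ := by
    intro i hi T
    induction T using Finset.induction_on with
    | empty => intro _; exact le_rfl
    | insert j T hj ih =>
      intro hT
      have h1 := ih ((Finset.subset_insert _ _).trans hT)
      have hjM := Finset.mem_erase.1 (hT (Finset.mem_insert_self j T))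
      have h2 := hMi i hi j hjM.2 hjM.1.symm
      rw [hA, not_lt] at h2
      refine le_trans ?_ h1
      rw [hBd, hBd, Finset.sum_insert hj, Finset.sum_insert hj, Finset.card_insert_of_notMem hj]
      have e1 := φsub i _ _ (hX0 j) (sX0 T)
      have e2 := ψsub i _ _ (hY0 j) (sY0 T)
      push_cast
      linarith
  have hSex : ∀ i, ∃ S ⊆ M.erase i, (∀ T ⊆ M.erase i, B i T ≤ B i S) ∧ (i ∈ M → S = ∅) := by
    intro i
    by_cases hi : i ∈ M
    · exact ⟨∅, Finset.empty_subset _, hBM i hi, fun _ => rfl⟩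
    · obtain ⟨S, hS, hmax⟩ := (M.erase i).powerset.exists_max_image (B i)
        ⟨∅, Finset.empty_mem_powerset _⟩
      exact ⟨S, Finset.mem_powerset.1 hS, fun T hT => hmax T (Finset.mem_powerset.2 hT),
        fun h => absurd h hi⟩
  choose S hSs hSm hSe using hSex
  obtain ⟨x, hx⟩ : ∃ x : Fin n → ℝ, ∀ i, x i =
    max (X i) (∑ j ∈ S i, X j) - ∑ j ∈ S i, X j := ⟨_, fun i => rfl⟩
  obtain ⟨y, hy⟩ : ∃ y : Fin n → ℝ, ∀ i, y i =
    max (Y i) (∑ j ∈ S i, Y j) - ∑ j ∈ S i, Y j := ⟨_, fun i => rfl⟩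
  have hx0 : ∀ i, 0 ≤ x i := fun i => by rw [hx]; exact sub_nonneg.2 (le_max_right _ _)
  have hy0 : ∀ i, 0 ≤ y i := fun i => by rw [hy]; exact sub_nonneg.2 (le_max_right _ _)
  have hxM : ∀ i ∈ M, x i = X i := fun i hi => by
    rw [hx, hSe i hi]; simp [hX0 i]
  have hyM : ∀ i ∈ M, y i = Y i := fun i hi => by
    rw [hy, hSe i hi]; simp [hY0 i]
  have sxM : ∀ T ⊆ M, ∑ j ∈ T, x j = ∑ j ∈ T, X j := fun T hT =>
    Finset.sum_congr rfl fun j hj => hxM j (hT hj)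
  have syM : ∀ T ⊆ M, ∑ j ∈ T, y j = ∑ j ∈ T, Y j := fun T hT =>
    Finset.sum_congr rfl fun j hj => hyM j (hT hj)
  have hSM' : ∀ i, S i ⊆ M := fun i => (hSs i).trans (Finset.erase_subset _ _)
  -- non-members contribute little
  have hxk : ∀ i, i ∉ M → c * x i ≤ k := by
    intro i hi
    by_cases hpS : p1 ∈ S i
    · have : X p1 ≤ ∑ j ∈ S i, X j := Finset.single_le_sum (fun j _ => hX0 j) hpS
      rw [hx, max_eq_right ((Xp1 i).trans this)]
      simp [hk.le]
    · have hne : p1 ≠ i := fun h => hi (h ▸ hp1M)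
      have e := hSm i (insert p1 (S i)) (Finset.insert_subset
        (Finset.mem_erase.2 ⟨hne, hp1M⟩) (hSs i))
      rw [hBd, hBd, Finset.sum_insert hpS, Finset.sum_insert hpS,
        Finset.card_insert_of_notMem hpS, Yp1, zero_add, add_comm (X p1)] at e
      have e2 := φbig i _ (sX0 (S i))
      rw [← hx] at e2
      push_cast at e
      linarith
  have hyk : ∀ i, i ∉ M → c * y i ≤ k := by
    intro i hi
    by_cases hpS : p0 ∈ S i
    · have : Y p0 ≤ ∑ j ∈ S i, Y j := Finset.single_le_sum (fun j _ => hY0 j) hpS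
      rw [hy, max_eq_right ((Yp0 i).trans this)]
      simp [hk.le]
    · have hne : p0 ≠ i := fun h => hi (h ▸ hp0M)
      have e := hSm i (insert p0 (S i)) (Finset.insert_subset
        (Finset.mem_erase.2 ⟨hne, hp0M⟩) (hSs i))
      rw [hBd, hBd, Finset.sum_insert hpS, Finset.sum_insert hpS,
        Finset.card_insert_of_notMem hpS, Xp0, zero_add, add_comm (Y p0)] at e
      have e2 := ψbig i _ (sY0 (S i))
      rw [← hy] at e2
      push_cast at e
      linarith
  have hsmall : ∀ i, i ∉ M → c * (x i + y i) ≤ k := by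
    intro i hi
    have hne : (S i).Nonempty := by
      rw [Finset.nonempty_iff_ne_empty]
      intro h
      obtain ⟨a, ha, hAa⟩ := hMa i hi
      have hai : a ≠ i := fun h => hi (h ▸ ha)
      have e := hSm i {a} (by simp [ha, hai])
      rw [hA] at hAa
      rw [h, hBd, hBd] at e
      simp at e
      linarith
    obtain ⟨m, hm⟩ := hne
    have m1 : X m ≤ ∑ j ∈ S i, X j := Finset.single_le_sum (fun j _ => hX0 j) hm
    have m2 : Y m ≤ ∑ j ∈ S i, Y j := Finset.single_le_sum (fun j _ => hY0 j) hm
    rcases le_total (t i) (t m) with h | h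
    · have : x i = 0 := by rw [hx, max_eq_right ((Xm' _ _ h).trans m1), sub_self]
      rw [this, zero_add]; exact hyk i hi
    · have : y i = 0 := by rw [hy, max_eq_right ((Ym' _ _ h).trans m2), sub_self]
      rw [this, add_zero]; exact hxk i hi
  -- deviations in the link set
  have hdev : ∀ i, ∀ T : Finset (Fin n), i ∉ T →
      φ i (∑ j ∈ T, x j) + ψ i (∑ j ∈ T, y j) - T.card * k ≤ B i (S i) := by
    intro i T hiT
    have hT' : T.filter (· ∈ M) ⊆ M.erase i := by
      intro j hj
      rw [Finset.mem_filter] at hj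
      exact Finset.mem_erase.2 ⟨fun h => hiT (h ▸ hj.1), hj.2⟩
    refine le_trans ?_ (hSm i _ hT')
    rw [hBd, ← sxM _ (hT'.trans (Finset.erase_subset _ _)),
      ← syM _ (hT'.trans (Finset.erase_subset _ _)),
      ← Finset.sum_filter_add_sum_filter_not T (· ∈ M) x,
      ← Finset.sum_filter_add_sum_filter_not T (· ∈ M) y,
      ← Finset.card_filter_add_card_filter_not (s := T) (· ∈ M)]
    have e1 := φadd i (∑ j ∈ T.filter (· ∈ M), x j) (∑ j ∈ T.filter (¬ · ∈ M), x j)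
      (Finset.sum_nonneg fun j _ => hx0 j) (Finset.sum_nonneg fun j _ => hx0 j)
    have e2 := ψadd i (∑ j ∈ T.filter (· ∈ M), y j) (∑ j ∈ T.filter (¬ · ∈ M), y j)
      (Finset.sum_nonneg fun j _ => hy0 j) (Finset.sum_nonneg fun j _ => hy0 j)
    have e3 : c * ∑ j ∈ T.filter (¬ · ∈ M), x j + c * ∑ j ∈ T.filter (¬ · ∈ M), y j
        ≤ (T.filter (¬ · ∈ M)).card * k := by
      rw [← mul_add, ← Finset.sum_add_distrib, Finset.mul_sum, ← nsmul_eq_mul]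
      exact Finset.sum_le_card_nsmul _ _ _ fun j hj => hsmall j (Finset.mem_filter.1 hj).2
    push_cast
    linarith
  refine ⟨x, y, fun i j => decide (j ∈ S i), hx0, hy0, ?_, ?_⟩
  · intro i
    simpa using fun h => (Finset.mem_erase.1 (hSs i h)).1 rfl
  · intro i xi yi gi hxi hyi hgi
    have hR : payoff t f c k x y (fun i j => decide (j ∈ S i)) i = B i (S i) := by
      have s1 : spill x (fun i j => decide (j ∈ S i)) i = ∑ j ∈ S i, X j := by
        rw [← sxM _ (hSM' i)]; simp [spill]
      have s2 : spill y (fun i j => decide (j ∈ S i)) i = ∑ j ∈ S i, Y j := by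
        rw [← syM _ (hSM' i)]; simp [spill]
      have s3 : nlinks (fun i j => decide (j ∈ S i)) i = (S i).card := by simp [nlinks]
      rw [payoff, s1, s2, s3, hBd, hφ, hψ, hx, hy]
      simp only [val, sub_add_cancel]
      ring
    rw [hR]
    obtain ⟨T, hTd⟩ : ∃ T, T = Finset.univ.filter (fun j => gi j = true) := ⟨_, rfl⟩
    have hiT : i ∉ T := by simp [hTd, hgi]
    have hsp : ∀ (z : Fin n → ℝ) (zi : ℝ),
        spill (Function.update z i zi) (updLinks (fun i j => decide (j ∈ S i)) i gi) i
          = ∑ j ∈ T, z j := by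
      intro z zi
      rw [hTd, Finset.sum_filter]
      unfold spill
      refine Finset.sum_congr rfl fun j _ => ?_
      by_cases hj : j = i
      · subst hj; simp [updLinks, hgi]
      · simp [updLinks, hj]
    have hnl : nlinks (updLinks (fun i j => decide (j ∈ S i)) i gi) i = T.card := by
      rw [hTd]; simp [nlinks, updLinks]
    refine le_trans ?_ (hdev i T hiT)
    rw [payoff, hsp, hsp, hnl, Function.update_self, Function.update_self]
    have e1 := val_ge hC (hw i) (hX i) (a := ∑ j ∈ T, x j) (z := xi + ∑ j ∈ T, x j)
      (Finset.sum_nonneg fun j _ => hx0 j) (by linarith)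
    have e2 := val_ge hC (hw' i) (hY i) (a := ∑ j ∈ T, y j) (z := yi + ∑ j ∈ T, y j)
      (Finset.sum_nonneg fun j _ => hy0 j) (by linarith)
    rw [hφ, hψ]
    simp only
    linarith
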